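/- In the polynomial ring ℤ[x₁,x₂,x₃], the degree-8 homogeneous component of ∏_{1≤i≤j≤l≤3} (1 + xᵢ + xⱼ + x_l) equals 120e₁⁵e₃ + 132e₁⁴e₂² + 1116e₁³e₂e₃ + 246e₁²e₂³ + 81e₁²e₃² + 567e₁e₂²e₃ + 36e₂⁴ + 243e₂e₃². -/

import Mathlib

open MvPolynomial

/-- `x₁`, `x₂`, `x₃` in `ℤ[x₁,x₂,x₃]`. -/
noncomputable def x1 : MvPolynomial (Fin 3) ℤ := X 0
noncomputable def x2 : MvPolynomial (Fin 3) ℤ := X 1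
noncomputable def x3 : MvPolynomial (Fin 3) ℤ := X 2

/-- the elementary symmetric polynomials in three variables -/
noncomputable def e1 : MvPolynomial (Fin 3) ℤ := x1 + x2 + x3
noncomputable def e2 : MvPolynomial (Fin 3) ℤ := x1*x2 + x1*x3 + x2*x3
noncomputable def e3 : MvPolynomial (Fin 3) ℤ := x1*x2*x3

/-- The product `∏_{1≤i≤j≤l≤3} (1 + xᵢ + xⱼ + x_l)` over the ten triples
`(i,j,l)` with `1 ≤ i ≤ j ≤ l ≤ 3`; by the splitting principle this is the
total Chern class of `S³E` for `E` of rank `3` with Chern roots `x₁,x₂,x₃`. -/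
noncomputable def sym3Prod : MvPolynomial (Fin 3) ℤ :=
  (1 + x1 + x1 + x1) * (1 + x1 + x1 + x2) * (1 + x1 + x1 + x3) *
  (1 + x1 + x2 + x2) * (1 + x1 + x2 + x3) * (1 + x1 + x3 + x3) *
  (1 + x2 + x2 + x2) * (1 + x2 + x2 + x3) * (1 + x2 + x3 + x3) *
  (1 + x3 + x3 + x3)

/-- Monomials in the elementary symmetric polynomials. -/
noncomputable def mon (a b c : ℕ) : MvPolynomial (Fin 3) ℤ := e1^a * e2^b * e3^c

lemma mon_homogeneous (a b c : ℕ) : (mon a b c).IsHomogeneous (1 * a + 2 * b + 3 * c) := by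
  have h1 : x1.IsHomogeneous 1 := isHomogeneous_X _ _
  have h2 : x2.IsHomogeneous 1 := isHomogeneous_X _ _
  have h3 : x3.IsHomogeneous 1 := isHomogeneous_X _ _
  have k1 : e1.IsHomogeneous 1 := (h1.add h2).add h3
  have k2 : e2.IsHomogeneous 2 := ((h1.mul h2).add (h1.mul h3)).add (h2.mul h3)
  have k3 : e3.IsHomogeneous 3 := (h1.mul h2).mul h3
  exact ((k1.pow a).mul (k2.pow b)).mul (k3.pow c)

lemma component_mon (a b c : ℕ) :
    homogeneousComponent 8 (mon a b c) =
      if 1 * a + 2 * b + 3 * c = 8 then mon a b c else 0 := by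
  have h := homogeneousComponent_of_mem (m := 8)
    ((mem_homogeneousSubmodule _ _).2 (mon_homogeneous a b c))
  rw [h]
  simp only [eq_comm]

lemma cubic_part (x y z : MvPolynomial (Fin 3) ℤ) :
    (1 + x + x + x) * (1 + y + y + y) * (1 + z + z + z) =
      1 + 3 * (x + y + z) + 9 * (x*y + x*z + y*z) + 27 * (x*y*z) := by ring

lemma sextic_part :
    (1 + x1 + x1 + x2) * (1 + x1 + x1 + x3) * (1 + x1 + x2 + x2) *
    (1 + x1 + x3 + x3) * (1 + x2 + x2 + x3) * (1 + x2 + x3 + x3) =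
      1 + 6*e1 + 13*e1^2 + 6*e2 + 12*e1^3 + 24*e1*e2 + 4*e1^4 + 30*e1^2*e2 + 9*e2^2
      + 12*e1^3*e2 + 18*e1*e2^2
      + 4*e1^3*e3 + 8*e1^2*e2^2 - 18*e1*e2*e3 + 4*e2^3 + 27*e3^2 := by
  unfold e1 e2 e3
  ring

/-- The total Chern class expanded in the elementary symmetric polynomials. -/
lemma sym3Prod_eq : sym3Prod =
    (1 : ℤ) • mon 0 0 0
    + (10 : ℤ) • mon 1 0 0
    + (40 : ℤ) • mon 2 0 0
    + (15 : ℤ) • mon 0 1 0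
    + (82 : ℤ) • mon 3 0 0
    + (111 : ℤ) • mon 1 1 0
    + (27 : ℤ) • mon 0 0 1
    + (91 : ℤ) • mon 4 0 0
    + (315 : ℤ) • mon 2 1 0
    + (63 : ℤ) • mon 0 2 0
    + (189 : ℤ) • mon 1 0 1
    + (52 : ℤ) • mon 5 0 0
    + (429 : ℤ) • mon 3 1 0
    + (324 : ℤ) • mon 1 2 0
    + (513 : ℤ) • mon 2 0 1
    + (162 : ℤ) • mon 0 1 1
    + (12 : ℤ) • mon 6 0 0
    + (282 : ℤ) • mon 4 1 0
    + (593 : ℤ) • mon 2 2 0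
    + (679 : ℤ) • mon 3 0 1
    + (85 : ℤ) • mon 0 3 0
    + (792 : ℤ) • mon 1 1 1
    + (27 : ℤ) • mon 0 0 2
    + (72 : ℤ) • mon 5 1 0
    + (464 : ℤ) • mon 3 2 0
    + (448 : ℤ) • mon 4 0 1
    + (259 : ℤ) • mon 1 3 0
    + (1386 : ℤ) • mon 2 1 1
    + (243 : ℤ) • mon 0 2 1
    + (108 : ℤ) • mon 1 0 2
    + (132 : ℤ) • mon 4 2 0
    + (120 : ℤ) • mon 5 0 1
    + (246 : ℤ) • mon 2 3 0
    + (1116 : ℤ) • mon 3 1 1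
    + (36 : ℤ) • mon 0 4 0
    + (567 : ℤ) • mon 1 2 1
    + (81 : ℤ) • mon 2 0 2
    + (243 : ℤ) • mon 0 1 2
    + (72 : ℤ) • mon 3 3 0
    + (360 : ℤ) • mon 4 1 1
    + (36 : ℤ) • mon 1 4 0
    + (540 : ℤ) • mon 2 2 1
    + (108 : ℤ) • mon 3 0 2
    + (108 : ℤ) • mon 0 3 1
    + (-243 : ℤ) • mon 1 1 2
    + (729 : ℤ) • mon 0 0 3
    + (216 : ℤ) • mon 3 2 1
    + (108 : ℤ) • mon 4 0 2
    + (108 : ℤ) • mon 1 3 1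
    + (-486 : ℤ) • mon 2 1 2
    + (729 : ℤ) • mon 1 0 3 := by
  have h : sym3Prod = (1 + e1) * (1 + 3 * e1 + 9 * e2 + 27 * e3) *
      (1 + 6*e1 + 13*e1^2 + 6*e2 + 12*e1^3 + 24*e1*e2 + 4*e1^4 + 30*e1^2*e2 + 9*e2^2
      + 12*e1^3*e2 + 18*e1*e2^2
      + 4*e1^3*e3 + 8*e1^2*e2^2 - 18*e1*e2*e3 + 4*e2^3 + 27*e3^2) := by
    rw [← sextic_part, show 1 + 3 * e1 + 9 * e2 + 27 * e3 = _ from (cubic_part x1 x2 x3).symm]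
    unfold sym3Prod e1
    generalize x1 = x, x2 = y, x3 = z
    rw [show 1 + (x + y + z) = 1 + x + y + z by ring]
    ac_rfl
  rw [h]
  simp only [mon, zsmul_eq_mul]
  push_cast
  ring

/-- The paper's formula for `c_8(S³E)`: the degree-`8` homogeneous component
of `∏_{1≤i≤j≤l≤3} (1 + xᵢ + xⱼ + x_l)`. -/
theorem chern_sym3_deg8 :
    homogeneousComponent 8 sym3Prod = 120*e1^5*e3 + 132*e1^4*e2^2 + 1116*e1^3*e2*e3 + 246*e1^2*e2^3 + 81*e1^2*e3^2 + 567*e1*e2^2*e3 + 36*e2^4 + 243*e2*e3^2 := by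
  rw [sym3Prod_eq]
  simp only [map_add, map_smul, component_mon]
  norm_num
  simp only [mon]
  ring
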